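/- (Unweighted Córdoba–Fefferman covering lemma, the case W ≡ 1.) Let d ≥ 1 and 1 < p < ∞. There is a constant C = C(p, d) such that for every countable collection {R_j}_{j≥1} of axis-parallel rectangles in ℝ^d there exists a subsequence {R̂_k}_{k≥1} of the collection satisfying (i) vol(∪_j R_j) ≤ C · vol(∪_k R̂_k), and (ii) ∫_{ℝ^d} (∑_k χ_{R̂_k}(x))^p dx ≤ C · vol(∪_k R̂_k), where vol is Lebesgue measure and χ denotes the indicator function. -/

import Mathlib

open MeasureTheory ENNReal Set

noncomputable section

/-- An axis-parallel rectangle (box) in `ℝ^d`: a product of `d` bounded intervals. -/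
def IsBox {d : ℕ} (S : Set (Fin d → ℝ)) : Prop :=
  ∃ I : Fin d → Set ℝ, (∀ i, Bornology.IsBounded (I i) ∧ (I i).OrdConnected) ∧
    S = Set.univ.pi I

/-- The measure `W(x) dx` on `ℝ^d`; `wVol W E = vol_W(E) = ∫_E W`. -/
def wVol {d : ℕ} (W : (Fin d → ℝ) → ℝ) : Measure (Fin d → ℝ) :=
  volume.withDensity fun x => ENNReal.ofReal (W x)



def mxf {X : Type*} [MeasureSpace X] (A : ℕ → Set X) (f : X → ℝ≥0∞) (x : X) : ℝ≥0∞ :=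
  ⨆ j, (A j).indicator (fun _ => (volume (A j))⁻¹ * ∫⁻ y in A j, f y) x

def MBdd {X : Type*} [MeasureSpace X] (q : ℝ) (K : ℝ≥0∞) (A : ℕ → Set X) : Prop :=
  ∀ f : X → ℝ≥0∞, Measurable f → ∫⁻ x, mxf A f x ^ q ≤ K * ∫⁻ x, f x ^ q

lemma mxf_measurable {X : Type*} [MeasureSpace X] {A : ℕ → Set X} (hA : ∀ j, MeasurableSet (A j))
    (f : X → ℝ≥0∞) : Measurable (mxf A f) :=
  Measurable.iSup fun j => measurable_const.indicator (hA j)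

lemma le_mxf {X : Type*} [MeasureSpace X] (A : ℕ → Set X) (f : X → ℝ≥0∞) {x : X} {j : ℕ}
    (hx : x ∈ A j) : (volume (A j))⁻¹ * ∫⁻ y in A j, f y ≤ mxf A f x := by
  refine le_trans ?_ (le_iSup _ j)
  simp [hx]

lemma mxf_lt_iff {X : Type*} [MeasureSpace X] (A : ℕ → Set X) (f : X → ℝ≥0∞) (x : X) (t : ℝ≥0∞) :
    t < mxf A f x ↔ ∃ j, x ∈ A j ∧ t < (volume (A j))⁻¹ * ∫⁻ y in A j, f y := by
  unfold mxf
  rw [lt_iSup_iff]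
  refine exists_congr fun j => ?_
  by_cases h : x ∈ A j <;> simp [h]

lemma mxf_le_iff {X : Type*} [MeasureSpace X] (A : ℕ → Set X) (f : X → ℝ≥0∞) (x : X) (t : ℝ≥0∞) :
    mxf A f x ≤ t ↔ ∀ j, x ∈ A j → (volume (A j))⁻¹ * ∫⁻ y in A j, f y ≤ t := by
  rw [← not_lt, mxf_lt_iff]; push Not; rfl

lemma MBdd.prod {X Y : Type*} [MeasureSpace X] [MeasureSpace Y]
    [SigmaFinite (volume : Measure X)] [SigmaFinite (volume : Measure Y)]
    {q : ℝ} (hq : 0 ≤ q) {K L : ℝ≥0∞} {A : ℕ → Set X} {B : ℕ → Set Y}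
    (hA : ∀ j, MeasurableSet (A j)) (hB : ∀ j, MeasurableSet (B j))
    (hA' : ∀ j, volume (A j) ≠ ⊤) (hB' : ∀ j, volume (B j) ≠ ⊤)
    (h1 : MBdd q K A) (h2 : MBdd q L B) : MBdd q (K * L) (fun j => A j ×ˢ B j) := by
  intro f hf
  have hmm : ∀ g : X × Y → ℝ≥0∞, Measurable g → Measurable
      (fun z : X × Y => mxf B (fun y => g (z.1, y)) z.2) := by
    intro g hg
    unfold mxf
    refine Measurable.iSup fun j => ?_
    have : (fun z : X × Y => (B j).indicator
        (fun _ => (volume (B j))⁻¹ * ∫⁻ y in B j, g (z.1, y)) z.2) =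
        (Prod.snd ⁻¹' (B j)).indicator
        (fun z : X × Y => (volume (B j))⁻¹ * ∫⁻ y in B j, g (z.1, y)) := by
      ext z; by_cases h : z.2 ∈ B j <;> simp [h]
    rw [this]
    refine Measurable.indicator ?_ (measurable_snd (hB j))
    refine Measurable.const_mul ?_ _
    exact (Measurable.lintegral_prod_right' (ν := volume.restrict (B j)) hg).comp measurable_fst
  set g : X × Y → ℝ≥0∞ := fun z => mxf B (fun y => f (z.1, y)) z.2 with hg
  have hgm : Measurable g := hmm f hf
  have hle : ∀ z : X × Y, mxf (fun j => A j ×ˢ B j) f z ≤ mxf A (fun x => g (x, z.2)) z.1 := by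
    rintro ⟨x, y⟩
    rw [mxf_le_iff]
    rintro j ⟨hx, hy⟩
    refine le_trans ?_ (le_mxf A _ hx)
    rw [Measure.volume_eq_prod, Measure.prod_prod, ← Measure.prod_restrict,
      lintegral_prod _ hf.aemeasurable, ENNReal.mul_inv (Or.inr (hB' j)) (Or.inl (hA' j)), mul_assoc,
      ← lintegral_const_mul _ (hf.lintegral_prod_right')]
    gcongr with x'
    exact le_mxf B (fun y => f (x', y)) hy
  have hm1 : Measurable (fun z : X × Y => mxf A (fun x => g (x, z.2)) z.1) := by
    unfold mxf
    refine Measurable.iSup fun j => ?_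
    have : (fun z : X × Y => (A j).indicator
        (fun _ => (volume (A j))⁻¹ * ∫⁻ x in A j, g (x, z.2)) z.1) =
        (Prod.fst ⁻¹' (A j)).indicator
        (fun z : X × Y => (volume (A j))⁻¹ * ∫⁻ x in A j, g (x, z.2)) := by
      ext z; by_cases h : z.1 ∈ A j <;> simp [h]
    rw [this]
    refine Measurable.indicator ?_ (measurable_fst (hA j))
    refine Measurable.const_mul ?_ _
    exact (Measurable.lintegral_prod_left' (μ := volume.restrict (A j)) hgm).comp measurable_snd
  calc ∫⁻ z, mxf (fun j => A j ×ˢ B j) f z ^ q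
      ≤ ∫⁻ z : X × Y, mxf A (fun x => g (x, z.2)) z.1 ^ q := by
        refine lintegral_mono fun z => ?_
        exact ENNReal.rpow_le_rpow (hle z) hq
    _ = ∫⁻ y : Y, ∫⁻ x : X, mxf A (fun x => g (x, y)) x ^ q := by
        rw [Measure.volume_eq_prod, lintegral_prod_symm _ (hm1.pow_const q).aemeasurable]
    _ ≤ ∫⁻ y : Y, K * ∫⁻ x : X, g (x, y) ^ q := by
        refine lintegral_mono fun y => h1 _ (by fun_prop)
    _ = K * ∫⁻ x : X, ∫⁻ y : Y, g (x, y) ^ q := by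
        rw [lintegral_const_mul _ (hgm.pow_const q).lintegral_prod_left',
          lintegral_lintegral_swap]
        exact ((hgm.pow_const q).comp measurable_swap).aemeasurable
    _ ≤ K * ∫⁻ x : X, L * ∫⁻ y : Y, f (x, y) ^ q := by
        gcongr with x
        exact h2 (fun y => f (x, y)) (by fun_prop)
    _ = K * L * ∫⁻ z, f z ^ q := by
        rw [lintegral_const_mul _ (hf.pow_const q).lintegral_prod_right', mul_assoc,
          Measure.volume_eq_prod, lintegral_prod _ (hf.pow_const q).aemeasurable]

lemma MBdd.transport {X Y : Type*} [MeasureSpace X] [MeasureSpace Y] (e : X ≃ᵐ Y)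
    (he : MeasurePreserving e) {q : ℝ} {K : ℝ≥0∞} {B : ℕ → Set Y}
    (hB : ∀ j, MeasurableSet (B j)) (h : MBdd q K B) : MBdd q K (fun j => e ⁻¹' (B j)) := by
  intro f hf
  have key : ∀ x, mxf (fun j => e ⁻¹' (B j)) f x = mxf B (fun y => f (e.symm y)) (e x) := by
    intro x
    unfold mxf
    refine iSup_congr fun j => ?_
    have h1 : volume (e ⁻¹' B j) = volume (B j) := he.measure_preimage (hB j).nullMeasurableSet
    have h2 : ∫⁻ y in e ⁻¹' B j, f y = ∫⁻ y in B j, f (e.symm y) := by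
      rw [← he.setLIntegral_comp_preimage (hB j) (by fun_prop)]
      simp
    rw [h1, h2]
    by_cases hx : e x ∈ B j <;> simp [hx]
  simp_rw [key]
  rw [he.lintegral_comp ((mxf_measurable hB _).pow_const q)]
  refine (h _ (by fun_prop)).trans ?_
  rw [← he.lintegral_comp (by fun_prop)]
  simp

/-- d-dimensional from one-dimensional. -/
lemma MBdd.pi {q : ℝ} (hq : 0 ≤ q) {K : ℝ≥0∞}
    (h1 : ∀ I : ℕ → Set ℝ, (∀ j, Bornology.IsBounded (I j) ∧ (I j).OrdConnected) → MBdd q K I)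
    (d : ℕ) (I : ℕ → Fin d → Set ℝ)
    (hI : ∀ j i, Bornology.IsBounded (I j i) ∧ (I j i).OrdConnected) :
    MBdd q (K ^ d) (fun j => Set.univ.pi (I j)) := by
  induction d with
  | zero =>
    intro f hf
    rw [pow_zero, one_mul]
    refine lintegral_mono fun x => ENNReal.rpow_le_rpow ?_ hq
    rw [mxf_le_iff]
    intro j _
    have : (Set.univ.pi (I j)) = Set.univ := by ext y; simp
    rw [this, Measure.restrict_univ]
    have hf' : f = fun _ => f x := by ext y; rw [Subsingleton.elim y x]
    rw [hf']
    have : volume (univ : Set (Fin 0 → ℝ)) = 1 := by simp [volume_pi]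
    simp [this]
  | succ d ih =>
    have e := ih (fun j i => I j i.succ) (fun j i => hI j i.succ)
    have e1 := h1 (fun j => I j 0) (fun j => hI j 0)
    have hm : ∀ j, MeasurableSet (Set.univ.pi (fun i : Fin d => I j i.succ)) := fun j =>
      MeasurableSet.univ_pi fun i => (hI j i.succ).2.measurableSet
    have hb : ∀ j, volume (Set.univ.pi (fun i : Fin d => I j i.succ)) ≠ ⊤ := fun j =>
      (Bornology.IsBounded.pi fun i : Fin d => (hI j i.succ).1).measure_lt_top.ne
    have hp := MBdd.prod hq (fun j => (hI j 0).2.measurableSet) hm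
      (fun j => (hI j 0).1.measure_lt_top.ne) hb e1 e
    have ht := MBdd.transport (MeasurableEquiv.piFinSuccAbove (fun _ : Fin (d+1) => ℝ) 0)
      (volume_preserving_piFinSuccAbove (fun _ : Fin (d+1) => ℝ) 0)
      (fun j => (hI j 0).2.measurableSet.prod (hm j)) hp
    rw [pow_succ']
    convert ht using 2 with j
    ext x
    simp [MeasurableEquiv.piFinSuccAbove, Fin.forall_fin_succ, Set.mem_pi, Fin.insertNthEquiv]
    exact fun _ => Iff.rfl

lemma interval_ball {I : Set ℝ} (h1 : Bornology.IsBounded I) (h2 : I.OrdConnected) :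
    ∃ c r : ℝ, I ⊆ Metric.closedBall c r ∧ volume I = ENNReal.ofReal (2 * r) := by
  rcases I.eq_empty_or_nonempty with rfl | hne
  · exact ⟨0, -1, by simp, by simp [ENNReal.ofReal_of_nonpos]⟩
  have hb := h1.bddBelow
  have ha := h1.bddAbove
  refine ⟨(sInf I + sSup I) / 2, (sSup I - sInf I) / 2, ?_, ?_⟩
  · intro x hx
    have := csInf_le hb hx
    have := le_csSup ha hx
    rw [Real.closedBall_eq_Icc]
    constructor <;> linarith
  · have e : 2 * ((sSup I - sInf I) / 2) = sSup I - sInf I := by ring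
    rw [e]
    apply le_antisymm
    · rw [← Real.volume_Icc]
      exact measure_mono fun x hx => ⟨csInf_le hb hx, le_csSup ha hx⟩
    · rw [← Real.volume_Ioo]
      refine measure_mono fun x hx => ?_
      obtain ⟨a, ha, hax⟩ := exists_lt_of_csInf_lt hne hx.1
      obtain ⟨b, hb, hbx⟩ := exists_lt_of_lt_csSup hne hx.2
      exact h2.out ha hb ⟨hax.le, hbx.le⟩

lemma weak_type (I : ℕ → Set ℝ) (hI : ∀ j, Bornology.IsBounded (I j) ∧ (I j).OrdConnected)
    (f : ℝ → ℝ≥0∞) (t : ℝ≥0∞) (ht : t ≠ 0) (ht' : t ≠ ⊤) :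
    t * volume {x | t < mxf I f x} ≤ 5 * ∫⁻ x, f x := by
  by_cases hfin : ∫⁻ x, f x = ⊤
  · rw [hfin]; simp
  choose c r hsub hvol using fun j => interval_ball (hI j).1 (hI j).2
  set T : Set ℕ := {j | t < (volume (I j))⁻¹ * ∫⁻ y in I j, f y} with hT
  have hv : ∀ j ∈ T, t * volume (I j) ≤ ∫⁻ y in I j, f y := by
    intro j hj
    have hj : t < (volume (I j))⁻¹ * ∫⁻ y in I j, f y := hj
    rw [mul_comm, ← div_eq_mul_inv] at hj
    exact (ENNReal.le_div_iff_mul_le (Or.inr (by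
      intro h; rw [h] at hj; simp at hj)) (Or.inl (hI j).1.measure_lt_top.ne)).1 hj.le
  have hr : ∀ j ∈ T, r j ≤ ((∫⁻ x, f x) / t).toReal := by
    intro j hj
    have h1 : volume (I j) ≤ (∫⁻ x, f x) / t := by
      rw [ENNReal.le_div_iff_mul_le (Or.inl ht) (Or.inl ht'), mul_comm]
      exact (hv j hj).trans (setLIntegral_le_lintegral _ _)
    rw [hvol, ENNReal.ofReal_le_iff_le_toReal (ENNReal.div_ne_top hfin ht)] at h1
    have : 0 ≤ ((∫⁻ x, f x) / t).toReal := ENNReal.toReal_nonneg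
    linarith
  obtain ⟨u, huT, hdisj, hcov⟩ :=
    Vitali.exists_disjoint_subfamily_covering_enlargement_closedBall T c r _ hr 5 (by norm_num)
  have hA : {x | t < mxf I f x} ⊆ ⋃ b ∈ u, Metric.closedBall (c b) (5 * r b) := by
    intro x hx
    obtain ⟨j, hxj, hj⟩ := (mxf_lt_iff _ _ _ _).1 hx
    obtain ⟨b, hb, hjb⟩ := hcov j hj
    exact mem_biUnion hb (hjb (hsub j hxj))
  calc t * volume {x | t < mxf I f x}
      ≤ t * ∑' b : u, volume (Metric.closedBall (c b) (5 * r b)) := by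
        gcongr
        exact (measure_mono hA).trans (measure_biUnion_le _ u.to_countable _)
    _ = t * ∑' b : u, 5 * volume (I b) := by
        congr 2; ext b
        rw [Real.volume_closedBall, hvol, show 2 * (5 * r b) = 5 * (2 * r b) by ring,
          ENNReal.ofReal_mul (by norm_num)]
        simp
    _ = 5 * ∑' b : u, t * volume (I b) := by
        rw [ENNReal.tsum_mul_left, ENNReal.tsum_mul_left]; ring
    _ ≤ 5 * ∑' b : u, ∫⁻ y in I b, f y := by
        gcongr with b
        exact hv b (huT b.2)
    _ = 5 * ∫⁻ y in ⋃ b ∈ u, I b, f y := by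
        rw [lintegral_biUnion u.to_countable (fun b _ => (hI b).2.measurableSet)
          (fun a ha b hb hab => (hdisj ha hb hab).mono (hsub a) (hsub b))]
    _ ≤ 5 * ∫⁻ x, f x := by
        gcongr
        exact Measure.restrict_le_self

lemma weak_type' (I : ℕ → Set ℝ) (hI : ∀ j, Bornology.IsBounded (I j) ∧ (I j).OrdConnected)
    (f : ℝ → ℝ≥0∞) (hf : Measurable f) (t : ℝ≥0∞) (ht : t ≠ 0) (ht' : t ≠ ⊤) :
    t * volume {x | t < mxf I f x} ≤ 10 * ∫⁻ x in {x | t < 2 * f x}, f x := by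
  have hms : MeasurableSet {x | t < 2 * f x} := measurableSet_lt (by fun_prop) (by fun_prop)
  rw [← lintegral_indicator hms]
  set g := {x | t < 2 * f x}.indicator f with hg
  have ht2 : t / 2 ≠ 0 := by simp [ht]
  have ht2' : t / 2 ≠ ⊤ := by simp [ENNReal.div_eq_top, ht']
  have hfg : ∀ x, f x ≤ g x + t / 2 := by
    intro x
    by_cases hx : t < 2 * f x
    · simp [hg, hx]
    · have : f x ≤ t / 2 := by
        rw [ENNReal.le_div_iff_mul_le (by simp) (by simp), mul_comm]; exact not_lt.1 hx
      exact this.trans le_add_self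
  have hsub : {x | t < mxf I f x} ⊆ {x | t / 2 < mxf I g x} := by
    intro x hx
    rw [mem_ofPred_eq, mxf_lt_iff] at hx ⊢
    obtain ⟨j, hj, hlt⟩ := hx
    refine ⟨j, hj, ?_⟩
    by_contra hcon
    rw [not_lt] at hcon
    refine absurd hlt (not_lt.2 ?_)
    calc (volume (I j))⁻¹ * ∫⁻ y in I j, f y
        ≤ (volume (I j))⁻¹ * ∫⁻ y in I j, (g y + t / 2) := by
          gcongr with y; exact hfg y
      _ = (volume (I j))⁻¹ * (∫⁻ y in I j, g y) + (volume (I j))⁻¹ * (t / 2 * volume (I j)) := by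
          rw [lintegral_add_right _ measurable_const, mul_add]; simp
      _ ≤ t / 2 + t / 2 := by
          gcongr
          rw [mul_left_comm]
          exact mul_le_of_le_one_right' (ENNReal.inv_mul_le_one _)
      _ = t := ENNReal.add_halves t
  calc t * volume {x | t < mxf I f x} ≤ t * volume {x | t / 2 < mxf I g x} := by gcongr
    _ = 2 * (t / 2 * volume {x | t / 2 < mxf I g x}) := by
      rw [← mul_assoc, ENNReal.mul_div_cancel (by simp) (by simp)]
    _ ≤ 2 * (5 * ∫⁻ x, g x) := by
      exact mul_le_mul' le_rfl (weak_type I hI g _ ht2 ht2')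
    _ = 10 * ∫⁻ x, g x := by rw [← mul_assoc]; norm_num

lemma layer (r : ℝ) (hr : 0 < r) (x : ℝ≥0∞) :
    ∫⁻ t in Ioi (0:ℝ), {t : ℝ | ENNReal.ofReal t < x}.indicator
      (fun t => ENNReal.ofReal (t ^ (r - 1))) t = ENNReal.ofReal r⁻¹ * x ^ r := by
  have hfin : ∀ a : ℝ, 0 ≤ a → ∫⁻ t in Ioo (0:ℝ) a, ENNReal.ofReal (t ^ (r - 1))
      = ENNReal.ofReal r⁻¹ * ENNReal.ofReal a ^ r := by
    intro a ha
    rw [setLIntegral_congr Ioo_ae_eq_Ioc, ← ofReal_integral_eq_lintegral_ofReal,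
      ← intervalIntegral.integral_of_le ha, integral_rpow (Or.inl (by linarith)),
      ENNReal.ofReal_rpow_of_nonneg ha hr.le, ← ENNReal.ofReal_mul (by positivity)]
    · congr 1
      rw [sub_add_cancel, Real.zero_rpow hr.ne']; field_simp; ring
    · exact (intervalIntegrable_iff_integrableOn_Ioc_of_le ha).1
        (intervalIntegral.intervalIntegrable_rpow' (by linarith))
    · filter_upwards [ae_restrict_mem measurableSet_Ioc] with t ht
      exact Real.rpow_nonneg ht.1.le _
  have hms : MeasurableSet {t : ℝ | ENNReal.ofReal t < x} :=
    measurableSet_lt (by fun_prop) (by fun_prop)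
  rw [lintegral_indicator hms, Measure.restrict_restrict hms]
  by_cases hx : x = ⊤
  · subst hx
    rw [ENNReal.top_rpow_of_pos hr, ENNReal.mul_top (by simpa using hr)]
    refine ENNReal.eq_top_of_forall_nnreal_le fun b => ?_
    have hb := hfin ((r * b) ^ r⁻¹) (by positivity)
    rw [ENNReal.ofReal_rpow_of_nonneg (by positivity) hr.le, ← Real.rpow_mul (by positivity),
      inv_mul_cancel₀ hr.ne', Real.rpow_one, ← ENNReal.ofReal_mul (by positivity),
      inv_mul_cancel_left₀ hr.ne', ENNReal.ofReal_coe_nnreal] at hb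
    rw [← hb]
    refine lintegral_mono_set fun t ht => ?_
    simp [ht.1]
  · rw [← ENNReal.ofReal_toReal hx, ← hfin _ ENNReal.toReal_nonneg]
    congr 2
    ext t
    constructor
    · rintro ⟨h1, h2⟩
      exact ⟨h2, (ENNReal.ofReal_lt_ofReal_iff_of_nonneg (le_of_lt h2)).1 h1⟩
    · rintro ⟨h1, h2⟩
      exact ⟨(ENNReal.ofReal_lt_ofReal_iff_of_nonneg h1.le).2 h2, h1⟩

lemma layer_int {g h : ℝ → ℝ≥0∞} (hg : Measurable g) (hh : Measurable h) (r : ℝ) (hr : 0 < r) :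
    ∫⁻ x, g x * h x ^ r = ENNReal.ofReal r * ∫⁻ t in Ioi (0:ℝ),
      ENNReal.ofReal (t ^ (r - 1)) * ∫⁻ x in {x | ENNReal.ofReal t < h x}, g x := by
  have e1 : ∀ x, g x * h x ^ r = ENNReal.ofReal r * ∫⁻ t in Ioi (0:ℝ),
      g x * {t : ℝ | ENNReal.ofReal t < h x}.indicator
      (fun t => ENNReal.ofReal (t ^ (r - 1))) t := by
    intro x
    rw [lintegral_const_mul, layer r hr, mul_left_comm, ← mul_assoc (ENNReal.ofReal r),
      ← ENNReal.ofReal_mul hr.le, mul_inv_cancel₀ hr.ne']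
    · simp
    · exact Measurable.indicator (by fun_prop) (measurableSet_lt (by fun_prop) (by fun_prop))
  have hset : MeasurableSet {p : ℝ × ℝ | ENNReal.ofReal p.2 < h p.1} :=
    measurableSet_lt (by fun_prop) (by fun_prop)
  have hm : Measurable (fun p : ℝ × ℝ => g p.1 * {t : ℝ | ENNReal.ofReal t < h p.1}.indicator
      (fun t => ENNReal.ofReal (t ^ (r - 1))) p.2) := by
    have : (fun p : ℝ × ℝ => g p.1 * {t : ℝ | ENNReal.ofReal t < h p.1}.indicator
      (fun t => ENNReal.ofReal (t ^ (r - 1))) p.2) =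
      (fun p : ℝ × ℝ => g p.1 * {p : ℝ × ℝ | ENNReal.ofReal p.2 < h p.1}.indicator
      (fun p => ENNReal.ofReal (p.2 ^ (r - 1))) p) := by
      ext p; simp [indicator]
    rw [this]
    exact (by fun_prop : Measurable fun p : ℝ × ℝ => g p.1).mul
      (Measurable.indicator (by fun_prop) hset)
  simp_rw [e1]
  rw [lintegral_const_mul _ hm.lintegral_prod_right',
    lintegral_lintegral_swap hm.aemeasurable]
  congr 1
  refine lintegral_congr fun t => ?_
  rw [← lintegral_indicator (measurableSet_lt (by fun_prop) hh), ← lintegral_const_mul]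
  · refine lintegral_congr fun x => ?_
    by_cases hx : ENNReal.ofReal t < h x <;> simp [hx, mul_comm]
  · exact hg.indicator (measurableSet_lt (by fun_prop) hh)

lemma MBdd_one (q : ℝ) (hq : 1 < q) : ∃ K : ℝ≥0∞, K ≠ ⊤ ∧ ∀ I : ℕ → Set ℝ,
    (∀ j, Bornology.IsBounded (I j) ∧ (I j).OrdConnected) → MBdd q K I := by
  refine ⟨ENNReal.ofReal q * (10 * (ENNReal.ofReal (q - 1)⁻¹ * 2 ^ (q - 1))), ?_, ?_⟩
  · refine ENNReal.mul_ne_top (by simp) (ENNReal.mul_ne_top (by simp)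
      (ENNReal.mul_ne_top (by simp) (ENNReal.rpow_ne_top_of_nonneg (by linarith) (by simp))))
  intro I hI f hf
  have hM : Measurable (mxf I f) := mxf_measurable (fun j => (hI j).2.measurableSet) f
  have h1 := layer_int measurable_one hM q (by linarith)
  have h2 := layer_int hf (hf.const_mul 2) (q - 1) (by linarith)
  simp only [Pi.one_apply, one_mul, lintegral_one, Measure.restrict_apply_univ] at h1
  have h3 : ∫⁻ t in Ioi (0:ℝ), ENNReal.ofReal (t ^ (q - 1)) *
        volume {x | ENNReal.ofReal t < mxf I f x} ≤
      10 * ∫⁻ t in Ioi (0:ℝ), ENNReal.ofReal (t ^ (q - 1 - 1)) *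
        ∫⁻ x in {x | ENNReal.ofReal t < 2 * f x}, f x := by
    rw [← lintegral_const_mul' _ _ (by simp)]
    refine setLIntegral_mono' measurableSet_Ioi fun t ht => ?_
    have ht : 0 < t := ht
    have e : ENNReal.ofReal (t ^ (q - 1)) = ENNReal.ofReal (t ^ (q - 1 - 1)) * ENNReal.ofReal t := by
      rw [← ENNReal.ofReal_mul (by positivity), Real.rpow_sub_one ht.ne' (q - 1)]
      congr 1; field_simp
    rw [e, mul_assoc, mul_left_comm 10]
    exact mul_le_mul' le_rfl (weak_type' I hI f hf (ENNReal.ofReal t) (by simpa using ht) (by simp))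
  have h4 : ∫⁻ x, f x * (2 * f x) ^ (q - 1) = 2 ^ (q - 1) * ∫⁻ x, f x ^ q := by
    rw [← lintegral_const_mul _ (by fun_prop)]
    refine lintegral_congr fun x => ?_
    rw [ENNReal.mul_rpow_of_nonneg _ _ (by linarith), mul_left_comm]
    congr 1
    conv_lhs => rw [← ENNReal.rpow_one (f x)]
    rw [← ENNReal.rpow_mul, ← ENNReal.rpow_add_of_nonneg _ _ (by linarith) (by linarith)]
    congr 1; ring
  rw [h4] at h2
  rw [h1]
  calc _ ≤ ENNReal.ofReal q * (10 * ∫⁻ t in Ioi (0:ℝ), ENNReal.ofReal (t ^ (q - 1 - 1)) *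
        ∫⁻ x in {x | ENNReal.ofReal t < 2 * f x}, f x) := by gcongr
    _ = ENNReal.ofReal q * (10 * (ENNReal.ofReal (q - 1)⁻¹ *
        (2 ^ (q - 1) * ∫⁻ x, f x ^ q))) := by
      rw [h2, ← mul_assoc (ENNReal.ofReal (q - 1)⁻¹), ← ENNReal.ofReal_mul
        (inv_nonneg.2 (by linarith)), inv_mul_cancel₀ (by linarith), ENNReal.ofReal_one, one_mul]
    _ = _ := by ring

lemma exists_sel (P : ℕ → Set ℕ → Prop) : ∃ S : Set ℕ, ∀ j, j ∈ S ↔ P j (S ∩ Iio j) := by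
  let F : ∀ n : ℕ, (∀ m, m < n → Prop) → Prop := fun n ih => P n {i | ∃ h : i < n, ih i h}
  let b : ℕ → Prop := Nat.lt_wfRel.wf.fix F
  refine ⟨{n | b n}, fun j => ?_⟩
  have h : b j = F j (fun m _ => b m) := Nat.lt_wfRel.wf.fix_eq F j
  change b j ↔ _
  rw [h]
  change P j _ ↔ _
  have : {i | ∃ _ : i < j, b i} = {n | b n} ∩ Iio j := by
    ext i; simp [and_comm]
  rw [this]

lemma half_absorb {v e : ℝ≥0∞} (hv : v ≠ ⊤) (h : v ≤ e + v / 2) : v ≤ 2 * e := by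
  have h2 : v / 2 ≠ ⊤ := by simp [ENNReal.div_eq_top, hv]
  have h3 : v / 2 + v / 2 ≤ e + v / 2 := by rwa [ENNReal.add_halves]
  have h4 := (ENNReal.add_le_add_iff_right h2).1 h3
  calc v = v / 2 + v / 2 := (ENNReal.add_halves v).symm
    _ ≤ e + e := by gcongr
    _ = 2 * e := (two_mul e).symm

lemma part_one {X : Type*} [MeasureSpace X] {A : ℕ → Set X} (hA : ∀ j, MeasurableSet (A j))
    (hA' : ∀ j, volume (A j) ≠ ⊤) {K : ℝ≥0∞} (hK : MBdd 2 K A) (U : Set X) (hU : MeasurableSet U)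
    (h : ∀ j, A j ⊆ U ∨ volume (A j) / 2 < volume (A j ∩ U)) :
    volume (⋃ j, A j) ≤ (4 * K + 1) * volume U := by
  have hsub : (⋃ j, A j) ⊆ {x | (4 : ℝ≥0∞)⁻¹ ≤ mxf A (U.indicator 1) x ^ (2:ℝ)} ∪ U := by
    intro x hx
    obtain ⟨j, hj⟩ := mem_iUnion.1 hx
    rcases h j with h | h
    · exact Or.inr (h hj)
    · left
      have h1 := le_mxf A (U.indicator 1) hj
      rw [lintegral_indicator_one hU, Measure.restrict_apply hU, inter_comm] at h1
      have h0 : volume (A j) ≠ 0 := by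
        intro h0
        rw [measure_mono_null inter_subset_left h0] at h
        simp at h
      have h2 : (2 : ℝ≥0∞)⁻¹ ≤ mxf A (U.indicator 1) x := by
        refine le_trans ?_ h1
        calc (2 : ℝ≥0∞)⁻¹ = (volume (A j))⁻¹ * (volume (A j) / 2) := by
              rw [div_eq_mul_inv, ← mul_assoc, ENNReal.inv_mul_cancel h0 (hA' j), one_mul]
          _ ≤ _ := by gcongr
      have h3 := ENNReal.rpow_le_rpow h2 (by norm_num : (0:ℝ) ≤ 2)
      refine le_trans (le_of_eq ?_) h3
      rw [ENNReal.inv_rpow, ENNReal.rpow_two]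
      norm_num
  have hM := mul_meas_ge_le_lintegral (μ := volume)
    ((mxf_measurable hA (U.indicator 1)).pow_const (2:ℝ)) (4 : ℝ≥0∞)⁻¹
  have hB := hK (U.indicator 1) (measurable_one.indicator hU)
  have hI : ∫⁻ x, (U.indicator 1 x : ℝ≥0∞) ^ (2:ℝ) = volume U := by
    rw [← lintegral_indicator_one hU]
    refine lintegral_congr fun x => ?_
    by_cases hx : x ∈ U <;> simp [hx]
  rw [hI] at hB
  calc volume (⋃ j, A j)
      ≤ volume {x | (4 : ℝ≥0∞)⁻¹ ≤ mxf A (U.indicator 1) x ^ (2:ℝ)} + volume U :=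
        (measure_mono hsub).trans (measure_union_le _ _)
    _ = 4 * (4⁻¹ * volume {x | (4 : ℝ≥0∞)⁻¹ ≤ mxf A (U.indicator 1) x ^ (2:ℝ)}) + volume U := by
        rw [← mul_assoc, ENNReal.mul_inv_cancel (by simp) (by simp), one_mul]
    _ ≤ 4 * (K * volume U) + volume U :=
        add_le_add (mul_le_mul' le_rfl (hM.trans hB)) le_rfl
    _ = _ := by ring

lemma part_two {X : Type*} [MeasureSpace X] {A B : ℕ → Set X} (hA : ∀ j, MeasurableSet (A j))
    (hA' : ∀ j, volume (A j) ≠ ⊤) {p q : ℝ} (hpq : p.HolderConjugate q) {K : ℝ≥0∞} (hKt : K ≠ ⊤)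
    (hK : MBdd q K A) (hBm : ∀ j, MeasurableSet (B j)) (hB : ∀ j, B j = A j ∨ B j = ∅)
    (hE : ∀ j, volume (B j) ≤ 2 * volume (disjointed B j)) (n : ℕ) :
    ∫⁻ x, (∑ j ∈ Finset.range n, (B j).indicator 1 x) ^ p
      ≤ 4 * (4 * K + 1) ^ (p - 1) * volume (⋃ j, B j) := by
  set N : X → ℝ≥0∞ := fun x => ∑ j ∈ Finset.range n, (B j).indicator 1 x with hN
  have hNm : Measurable N := Finset.measurable_sum _ fun j _ => measurable_one.indicator (hBm j)
  have hp1 : 0 < p - 1 := by linarith [hpq.lt]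
  have hq1 : 0 < q - 1 := by linarith [hpq.symm.lt]
  have hBv : ∀ j, volume (B j) ≠ ⊤ := by
    intro j; rcases hB j with h | h <;> rw [h]
    · exact hA' j
    · simp
  have hNn : ∀ x, N x ≤ n := by
    intro x
    calc N x ≤ ∑ j ∈ Finset.range n, 1 := Finset.sum_le_sum fun j _ => by
          by_cases hx : x ∈ B j <;> simp [hx]
      _ = n := by simp
  have hpow : ∀ x, N x ^ p = N x * N x ^ (p - 1) := by
    intro x
    conv_rhs => rw [← ENNReal.rpow_one (N x)]
    rw [← ENNReal.rpow_mul, ← ENNReal.rpow_add_of_nonneg _ _ (by linarith) (by linarith)]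
    congr 1; ring
  have hintN : ∫⁻ x, N x ≠ ⊤ := by
    rw [hN, lintegral_finsetSum _ fun j _ => measurable_one.indicator (hBm j)]
    refine ENNReal.sum_ne_top.2 fun j _ => ?_
    rw [lintegral_indicator_one (hBm j)]; exact hBv j
  have hfin : ∫⁻ x, N x ^ p ≠ ⊤ := by
    refine ne_top_of_le_ne_top (ENNReal.mul_ne_top (a := (n : ℝ≥0∞) ^ (p - 1))
      (ENNReal.rpow_ne_top_of_nonneg hp1.le (by simp)) hintN) ?_
    rw [← lintegral_const_mul _ hNm]
    refine lintegral_mono fun x => ?_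
    change N x ^ p ≤ _
    rw [hpow, mul_comm]
    gcongr
    exact hNn x
  set φ : X → ℝ≥0∞ := fun x => N x ^ (p - 1) with hφ
  have hφm : Measurable φ := hNm.pow_const _
  have hφq : ∀ x, φ x ^ q = N x ^ p := by
    intro x
    rw [hφ]
    simp only
    rw [← ENNReal.rpow_mul, hpq.sub_one_mul_conj]
  have hMm := mxf_measurable hA φ
  have hMφ := hK φ hφm
  simp_rw [hφq] at hMφ
  -- each piece
  have hpiece : ∀ j, ∫⁻ x in B j, φ x ≤ 2 * ∫⁻ x in disjointed B j, mxf A φ x := by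
    intro j
    rcases hB j with h | h
    swap
    · rw [h]; simp
    by_cases h0 : volume (B j) = 0
    · rw [Measure.restrict_eq_zero.2 h0]; simp
    calc ∫⁻ x in B j, φ x = volume (B j) * ((volume (A j))⁻¹ * ∫⁻ x in A j, φ x) := by
          rw [← h, ← mul_assoc, ENNReal.mul_inv_cancel h0 (hBv j), one_mul]
      _ ≤ 2 * volume (disjointed B j) * ((volume (A j))⁻¹ * ∫⁻ x in A j, φ x) := by
          gcongr; exact hE j
      _ = 2 * ∫⁻ x in disjointed B j, ((volume (A j))⁻¹ * ∫⁻ x in A j, φ x) := by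
          rw [setLIntegral_const]; ring
      _ ≤ _ := by
          refine mul_le_mul' le_rfl (setLIntegral_mono' (MeasurableSet.disjointed hBm j) fun x hx => ?_)
          exact le_mxf A φ (h ▸ disjointed_subset B j hx)
  have hsum : ∫⁻ x, N x ^ p ≤ 2 * ∫⁻ x in ⋃ j, B j, mxf A φ x := by
    calc ∫⁻ x, N x ^ p = ∫⁻ x, ∑ j ∈ Finset.range n, (B j).indicator φ x := by
          refine lintegral_congr fun x => ?_
          rw [hpow, hN, Finset.sum_mul]
          refine Finset.sum_congr rfl fun j _ => ?_
          by_cases hx : x ∈ B j <;> simp [hx, hφ, hN]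
      _ = ∑ j ∈ Finset.range n, ∫⁻ x in B j, φ x := by
          rw [lintegral_finsetSum _ fun j _ => hφm.indicator (hBm j)]
          exact Finset.sum_congr rfl fun j _ => lintegral_indicator (hBm j) _
      _ ≤ ∑ j ∈ Finset.range n, 2 * ∫⁻ x in disjointed B j, mxf A φ x :=
          Finset.sum_le_sum fun j _ => hpiece j
      _ ≤ ∑' j, 2 * ∫⁻ x in disjointed B j, mxf A φ x := ENNReal.sum_le_tsum _
      _ = 2 * ∫⁻ x in ⋃ j, B j, mxf A φ x := by
          rw [ENNReal.tsum_mul_left, ← iUnion_disjointed,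
            lintegral_iUnion (fun j => MeasurableSet.disjointed hBm j) (disjoint_disjointed B)]
  set M : ℝ≥0∞ := 4 * K + 1 with hM
  have hMt : M ≠ ⊤ := by simp [hM, ENNReal.mul_eq_top, hKt]
  have hM0 : M ≠ 0 := by simp [hM]
  have hyoung : ∀ a : ℝ≥0∞, a ≤ M ^ (p - 1) + M⁻¹ * a ^ q := by
    intro a
    by_cases ha : a ≤ M ^ (p - 1)
    · exact ha.trans le_self_add
    · refine le_trans ?_ le_add_self
      have h1 : M ≤ a ^ (q - 1) := by
        have := ENNReal.rpow_le_rpow (not_le.1 ha).le hq1.le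
        rw [← ENNReal.rpow_mul] at this
        have e : (p - 1) * (q - 1) = 1 := by
          have := hpq.sub_one_mul_conj
          nlinarith
        rwa [e, ENNReal.rpow_one] at this
      have e : a ^ q = a ^ (q - 1) * a := by
        conv_rhs => rw [← ENNReal.rpow_one a]
        rw [← ENNReal.rpow_mul, ← ENNReal.rpow_add_of_nonneg _ _ (by linarith) (by linarith)]
        congr 1; ring
      calc a = M⁻¹ * (M * a) := by rw [← mul_assoc, ENNReal.inv_mul_cancel hM0 hMt, one_mul]
        _ ≤ M⁻¹ * a ^ q := by rw [e]; gcongr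
  have hUm : MeasurableSet (⋃ j, B j) := MeasurableSet.iUnion hBm
  have hbound : ∫⁻ x in ⋃ j, B j, mxf A φ x ≤
      M ^ (p - 1) * volume (⋃ j, B j) + M⁻¹ * (K * ∫⁻ x, N x ^ p) := by
    calc ∫⁻ x in ⋃ j, B j, mxf A φ x
        ≤ ∫⁻ x in ⋃ j, B j, (M ^ (p - 1) + M⁻¹ * mxf A φ x ^ q) := lintegral_mono fun x => hyoung _
      _ = M ^ (p - 1) * volume (⋃ j, B j) + M⁻¹ * ∫⁻ x in ⋃ j, B j, mxf A φ x ^ q := by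
          rw [lintegral_add_left measurable_const, setLIntegral_const,
            lintegral_const_mul _ (hMm.pow_const q)]
      _ ≤ _ := by
          gcongr
          exact (setLIntegral_le_lintegral _ _).trans hMφ
  have hMK : 2 * (M⁻¹ * K) ≤ 2⁻¹ := by
    have : 4 * (M⁻¹ * K) ≤ 1 := by
      calc 4 * (M⁻¹ * K) = M⁻¹ * (4 * K) := by ring
        _ ≤ M⁻¹ * M := by gcongr; exact le_self_add
        _ = 1 := ENNReal.inv_mul_cancel hM0 hMt
    calc 2 * (M⁻¹ * K) = 2⁻¹ * (4 * (M⁻¹ * K)) := by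
          rw [show (4 : ℝ≥0∞) = 2 * 2 by norm_num, mul_assoc 2 2, ← mul_assoc 2⁻¹,
            ENNReal.inv_mul_cancel (by simp) (by simp), one_mul]
      _ ≤ 2⁻¹ * 1 := by gcongr
      _ = _ := mul_one _
  have hfinal : ∫⁻ x, N x ^ p ≤ 2 * (M ^ (p - 1) * volume (⋃ j, B j)) + (∫⁻ x, N x ^ p) / 2 := by
    calc ∫⁻ x, N x ^ p
        ≤ 2 * (M ^ (p - 1) * volume (⋃ j, B j) + M⁻¹ * (K * ∫⁻ x, N x ^ p)) :=
          hsum.trans (mul_le_mul' le_rfl hbound)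
      _ = 2 * (M ^ (p - 1) * volume (⋃ j, B j)) + 2 * (M⁻¹ * K) * ∫⁻ x, N x ^ p := by ring
      _ ≤ 2 * (M ^ (p - 1) * volume (⋃ j, B j)) + 2⁻¹ * ∫⁻ x, N x ^ p := by gcongr
      _ = _ := by rw [div_eq_mul_inv, mul_comm 2⁻¹]
  refine (half_absorb hfin hfinal).trans (le_of_eq ?_)
  ring

lemma selection {X : Type*} [MeasureSpace X] {A : ℕ → Set X} (hA : ∀ j, MeasurableSet (A j))
    (hA' : ∀ j, volume (A j) ≠ ⊤) {p q : ℝ} (hpq : p.HolderConjugate q) {K K2 : ℝ≥0∞} (hKt : K ≠ ⊤)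
    (hK : MBdd q K A) (hK2 : MBdd 2 K2 A) :
    ∃ S : Set ℕ, volume (⋃ j, A j) ≤ (4 * K2 + 1) * volume (⋃ j ∈ S, A j) ∧
      (∫⁻ x, (∑' j : S, (A j).indicator (fun _ => (1 : ℝ≥0∞)) x) ^ p) ≤
        4 * (4 * K + 1) ^ (p - 1) * volume (⋃ j ∈ S, A j) := by
  classical
  obtain ⟨S, hS⟩ := exists_sel
    (fun j T => volume (A j ∩ ⋃ i ∈ T, A i) ≤ volume (A j) / 2)
  refine ⟨S, ?_, ?_⟩
  · refine part_one hA hA' hK2 _ (MeasurableSet.biUnion S.to_countable fun j _ => hA j) fun j => ?_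
    by_cases hj : j ∈ S
    · exact Or.inl (subset_biUnion_of_mem (u := A) hj)
    · right
      rw [hS, not_le] at hj
      refine hj.trans_le (measure_mono (inter_subset_inter_right _ ?_))
      exact biUnion_subset_biUnion_left inter_subset_left
  · set B : ℕ → Set X := fun j => if j ∈ S then A j else ∅ with hB
    have hU : (⋃ j ∈ S, A j) = ⋃ j, B j := by
      ext x; simp only [mem_iUnion, hB]
      refine exists_congr fun j => ?_
      by_cases hj : j ∈ S <;> simp [hj]
    have hBm : ∀ j, MeasurableSet (B j) := by
      intro j; by_cases hj : j ∈ S <;> simp [hB, hj, hA j]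
    have hBA : ∀ j, B j = A j ∨ B j = ∅ := by
      intro j; by_cases hj : j ∈ S <;> simp [hB, hj]
    have hE : ∀ j, volume (B j) ≤ 2 * volume (disjointed B j) := by
      intro j
      by_cases hj : j ∈ S
      swap
      · simp [hB, hj]
      have hBj : B j = A j := by simp [hB, hj]
      refine half_absorb (by rw [hBj]; exact hA' j) ?_
      have hsub : B j ⊆ disjointed B j ∪ (A j ∩ ⋃ i ∈ S ∩ Iio j, A i) := by
        intro x hx
        by_cases hx2 : ∃ i ∈ S ∩ Iio j, x ∈ A i
        · obtain ⟨i, hi, hxi⟩ := hx2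
          exact Or.inr ⟨hBj ▸ hx, mem_biUnion hi hxi⟩
        · left
          rw [disjointed_eq_inter_compl]
          refine ⟨hx, mem_iInter₂.2 fun i hi hxi => hx2 ?_⟩
          by_cases hiS : i ∈ S
          · exact ⟨i, ⟨hiS, hi⟩, by simpa [hB, hiS] using hxi⟩
          · simp [hB, hiS] at hxi
      refine (measure_mono hsub).trans ((measure_union_le _ _).trans ?_)
      gcongr
      rw [hBj]
      exact (hS j).1 hj
    rw [hU]
    have hts : ∀ x, (∑' j : S, (A j).indicator (fun _ => (1 : ℝ≥0∞)) x) ^ p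
        = ⨆ n, (∑ j ∈ Finset.range n, (B j).indicator 1 x) ^ p := by
      intro x
      rw [tsum_subtype S (fun j => (A j).indicator (fun _ => (1 : ℝ≥0∞)) x),
        ENNReal.tsum_eq_iSup_nat]
      have := (ENNReal.orderIsoRpow p hpq.pos).map_iSup
        (fun n => ∑ j ∈ Finset.range n, (B j).indicator (1 : X → ℝ≥0∞) x)
      simp only [ENNReal.orderIsoRpow_apply] at this
      rw [← this]
      congr 1
      refine iSup_congr fun n => Finset.sum_congr rfl fun j _ => ?_
      by_cases hj : j ∈ S <;> by_cases hx : x ∈ A j <;> simp [hB, hj, hx]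
    simp_rw [hts]
    rw [lintegral_iSup]
    · exact iSup_le fun n => part_two hA hA' hpq hKt hK hBm hBA hE n
    · intro n
      exact (Finset.measurable_sum _ fun j _ => measurable_one.indicator (hBm j)).pow_const p
    · intro m n hmn x
      refine ENNReal.rpow_le_rpow ?_ hpq.pos.le
      exact Finset.sum_le_sum_of_subset (Finset.range_mono hmn)

theorem cordoba_fefferman_covering
    (d : ℕ) (hd : 1 ≤ d) (p : ℝ) (hp : 1 < p) :
    ∃ C : ℝ, 0 < C ∧
      ∀ R : ℕ → Set (Fin d → ℝ), (∀ j, IsBox (R j)) →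
        ∃ S : Set ℕ,
          volume (⋃ j, R j) ≤ ENNReal.ofReal C * volume (⋃ j ∈ S, R j) ∧
          (∫⁻ x, (∑' j : S, (R j).indicator (fun _ => (1 : ℝ≥0∞)) x) ^ p) ≤
            ENNReal.ofReal C * volume (⋃ j ∈ S, R j) := by
  have hpq := Real.HolderConjugate.conjExponent hp
  set q := Real.conjExponent p
  obtain ⟨K, hKt, hK⟩ := MBdd_one q hpq.symm.lt
  obtain ⟨K2, hK2t, hK2⟩ := MBdd_one 2 (by norm_num)
  set C1 : ℝ≥0∞ := 4 * K2 ^ d + 1 with hC1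
  set C2 : ℝ≥0∞ := 4 * (4 * K ^ d + 1) ^ (p - 1) with hC2
  have hC1t : C1 ≠ ⊤ := by simp [hC1, ENNReal.mul_eq_top, ENNReal.pow_eq_top_iff, hK2t]
  have hC2t : C2 ≠ ⊤ := ENNReal.mul_ne_top (by simp)
    (ENNReal.rpow_ne_top_of_nonneg (by linarith)
      (by simp [ENNReal.mul_eq_top, ENNReal.pow_eq_top_iff, hKt]))
  have hCt : C1 + C2 ≠ ⊤ := ENNReal.add_ne_top.2 ⟨hC1t, hC2t⟩
  refine ⟨(C1 + C2).toReal, ENNReal.toReal_pos (by simp [hC1]) hCt, fun R hR => ?_⟩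
  rw [ENNReal.ofReal_toReal hCt]
  choose I hI hRI using hR
  obtain rfl : R = fun j => Set.univ.pi (I j) := funext hRI
  obtain ⟨S, h1, h2⟩ := selection
    (A := fun j => Set.univ.pi (I j))
    (fun j => MeasurableSet.univ_pi fun i => (hI j i).2.measurableSet)
    (fun j => (Bornology.IsBounded.pi fun i => (hI j i).1).measure_lt_top.ne)
    hpq (ENNReal.pow_ne_top hKt)
    (MBdd.pi (by linarith [hpq.symm.lt]) hK d I hI) (MBdd.pi (by norm_num) hK2 d I hI)
  exact ⟨S, h1.trans (mul_le_mul' le_self_add le_rfl), h2.trans (mul_le_mul' le_add_self le_rfl)⟩
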